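/- With the canonical bracket {F,G}_0 := Σ_i(∂F/∂μ_i ∂G/∂λ_i − ∂F/∂λ_i ∂G/∂μ_i) on smooth functions on U, for all real x ≠ y one has {C(x), A(y)}_0 = −(η/(x−y))·(C(x)A(y) − C(y)A(x)). -/

import Mathlib

noncomputable section

/-- The open set `U ⊂ ℝ^{2n}` of points `(λ, μ)` with the `λ_i` pairwise distinct. -/
def U (n : ℕ) : Set ((Fin n → ℝ) × (Fin n → ℝ)) := {z | Function.Injective z.1}

/-- `A(x) := α ∏_{i=1}^n (x − λ_i)`. -/
def Afun (n : ℕ) (α : ℝ) (x : ℝ) (z : (Fin n → ℝ) × (Fin n → ℝ)) : ℝ :=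
  α * ∏ i, (x - z.1 i)

/-- `A'(λ_i)`, the derivative of the polynomial `A` at `λ_i`. -/
def Ader (n : ℕ) (α : ℝ) (z : (Fin n → ℝ) × (Fin n → ℝ)) (i : Fin n) : ℝ :=
  deriv (fun x => Afun n α x z) (z.1 i)

/-- The polynomial `A(x)/(x − λ_i) = α ∏_{j ≠ i} (x − λ_j)`. -/
def lagr (n : ℕ) (α : ℝ) (z : (Fin n → ℝ) × (Fin n → ℝ)) (i : Fin n) (x : ℝ) : ℝ :=
  α * ∏ j ∈ Finset.univ.erase i, (x - z.1 j)

/-- `B(x) := A(x)(β/α + Σ_i e^{ημ_i}/((x−λ_i)A'(λ_i)))`, written with the polynomial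
`A(x)/(x−λ_i)`, so `B` is a polynomial in `x`. -/
def Bfun (n : ℕ) (α β η : ℝ) (x : ℝ) (z : (Fin n → ℝ) × (Fin n → ℝ)) : ℝ :=
  (β / α) * Afun n α x z + ∑ i, Real.exp (η * z.2 i) * lagr n α z i x / Ader n α z i

/-- `C(x) := A(x)(γ/α − Σ_i d(λ_i)e^{−ημ_i}/((x−λ_i)A'(λ_i)))`, written with the polynomial
`A(x)/(x−λ_i)`, so `C` is a polynomial in `x`. -/
def Cfun (n : ℕ) (α γ η : ℝ) (d : Polynomial ℝ) (x : ℝ)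
    (z : (Fin n → ℝ) × (Fin n → ℝ)) : ℝ :=
  (γ / α) * Afun n α x z
    - ∑ i, d.eval (z.1 i) * Real.exp (-(η * z.2 i)) * lagr n α z i x / Ader n α z i

/-- Partial derivative of `F` with respect to `λ_i`. -/
def pdLam {n : ℕ} (F : (Fin n → ℝ) × (Fin n → ℝ) → ℝ) (i : Fin n)
    (z : (Fin n → ℝ) × (Fin n → ℝ)) : ℝ :=
  fderiv ℝ F z (Pi.single i 1, 0)

/-- Partial derivative of `F` with respect to `μ_i`. -/
def pdMu {n : ℕ} (F : (Fin n → ℝ) × (Fin n → ℝ) → ℝ) (i : Fin n)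
    (z : (Fin n → ℝ) × (Fin n → ℝ)) : ℝ :=
  fderiv ℝ F z (0, Pi.single i 1)

/-- The canonical bracket `{F,G}_0 := Σ_i (∂F/∂μ_i ∂G/∂λ_i − ∂F/∂λ_i ∂G/∂μ_i)`. -/
def bracket0 {n : ℕ} (F G : (Fin n → ℝ) × (Fin n → ℝ) → ℝ)
    (z : (Fin n → ℝ) × (Fin n → ℝ)) : ℝ :=
  ∑ i, (pdMu F i z * pdLam G i z - pdLam F i z * pdMu G i z)

lemma Afun_eq_mul_lagr (n : ℕ) (α : ℝ) (z : (Fin n → ℝ) × (Fin n → ℝ)) (i : Fin n) (x : ℝ) :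
    Afun n α x z = (x - z.1 i) * lagr n α z i x := by
  simp only [Afun, lagr, ← Finset.mul_prod_erase Finset.univ _ (Finset.mem_univ i)]
  ring

/-- `A'(λ_i)` is the value at `λ_i` of the polynomial `A(x)/(x − λ_i)`. -/
lemma Ader_eq_lagr (n : ℕ) (α : ℝ) (z : (Fin n → ℝ) × (Fin n → ℝ)) (i : Fin n) :
    Ader n α z i = lagr n α z i (z.1 i) := by
  have hl : DifferentiableAt ℝ (lagr n α z i) (z.1 i) := by
    unfold lagr
    fun_prop
  have h := ((hasDerivAt_id' (z.1 i)).sub_const (z.1 i)).fun_mul hl.hasDerivAt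
  simp only [Ader, Afun_eq_mul_lagr n α z i]
  simpa using h.deriv

lemma Ader_ne_zero {n : ℕ} {α : ℝ} (hα : α ≠ 0) {z : (Fin n → ℝ) × (Fin n → ℝ)} (hz : z ∈ U n)
    (i : Fin n) : Ader n α z i ≠ 0 := by
  rw [Ader_eq_lagr]
  refine mul_ne_zero hα (Finset.prod_ne_zero_iff.2 fun j hj => sub_ne_zero.2 fun h => ?_)
  exact Finset.ne_of_mem_erase hj (hz h).symm

lemma differentiable_Afun (n : ℕ) (α x : ℝ) : Differentiable ℝ (Afun n α x) := by
  unfold Afun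
  fun_prop

lemma differentiableAt_Cfun {n : ℕ} {α : ℝ} (hα : α ≠ 0) (γ η : ℝ) (d : Polynomial ℝ) (x : ℝ)
    {z : (Fin n → ℝ) × (Fin n → ℝ)} (hz : z ∈ U n) :
    DifferentiableAt ℝ (Cfun n α γ η d x) z := by
  have hA := differentiable_Afun n α x z
  have hd (i : Fin n) :
      DifferentiableAt ℝ (fun w : (Fin n → ℝ) × (Fin n → ℝ) => d.eval (w.1 i)) z :=
    DifferentiableAt.comp z (g := fun t => d.eval t) d.differentiableAt (by fun_prop)
  have hl (i : Fin n) : DifferentiableAt ℝ (fun w => lagr n α w i x) z := by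
    unfold lagr
    fun_prop
  have hD (i : Fin n) : DifferentiableAt ℝ (fun w => Ader n α w i) z := by
    simp only [Ader_eq_lagr, lagr]
    fun_prop
  have he (i : Fin n) : DifferentiableAt ℝ
      (fun w : (Fin n → ℝ) × (Fin n → ℝ) => Real.exp (-(η * w.2 i))) z := by
    fun_prop
  have hterm (i : Fin n) : DifferentiableAt ℝ (fun w : (Fin n → ℝ) × (Fin n → ℝ) =>
      d.eval (w.1 i) * Real.exp (-(η * w.2 i)) * lagr n α w i x / Ader n α w i) z := by
    simp only [div_eq_mul_inv]
    exact (((hd i).fun_mul (he i)).fun_mul (hl i)).fun_mul ((hD i).fun_inv (Ader_ne_zero hα hz i))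
  exact (hA.const_mul _).fun_sub (DifferentiableAt.fun_sum fun i _ => hterm i)

lemma pdMu_Afun (n : ℕ) (α x : ℝ) (i : Fin n) (z : (Fin n → ℝ) × (Fin n → ℝ)) :
    pdMu (Afun n α x) i z = 0 := by
  rw [pdMu, ← (differentiable_Afun n α x z).lineDeriv_eq_fderiv]
  simp [lineDeriv, Afun]

lemma pdLam_Afun (n : ℕ) (α x : ℝ) (i : Fin n) (z : (Fin n → ℝ) × (Fin n → ℝ)) :
    pdLam (Afun n α x) i z = -lagr n α z i x := by
  rw [pdLam, ← (differentiable_Afun n α x z).lineDeriv_eq_fderiv, lineDeriv]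
  have h : (fun t : ℝ => Afun n α x (z + t • (Pi.single i 1, 0))) =
      fun t => (x - z.1 i - t) * lagr n α z i x := by
    funext t
    rw [Afun_eq_mul_lagr _ _ _ i]
    congr 1
    · simp; ring
    · unfold lagr
      congr 1
      refine Finset.prod_congr rfl fun j hj => ?_
      simp [Pi.single_eq_of_ne (Finset.ne_of_mem_erase hj)]
  rw [h]
  simp

lemma pdMu_Cfun {n : ℕ} {α : ℝ} (hα : α ≠ 0) (γ η : ℝ) (d : Polynomial ℝ) (x : ℝ) (i : Fin n)
    {z : (Fin n → ℝ) × (Fin n → ℝ)} (hz : z ∈ U n) :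
    pdMu (Cfun n α γ η d x) i z =
      η * (d.eval (z.1 i) * Real.exp (-(η * z.2 i)) * lagr n α z i x / Ader n α z i) := by
  rw [pdMu, ← (differentiableAt_Cfun hα γ η d x hz).lineDeriv_eq_fderiv, lineDeriv]
  have hterm (j : Fin n) : HasDerivAt (fun t : ℝ => d.eval (z.1 j) *
      Real.exp (-(η * (z.2 j + t * (Pi.single i 1 : Fin n → ℝ) j))) * lagr n α z j x / Ader n α z j)
      (-η * (Pi.single i 1 : Fin n → ℝ) j *
        (d.eval (z.1 j) * Real.exp (-(η * z.2 j)) * lagr n α z j x / Ader n α z j)) 0 := by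
    have h := (((((((hasDerivAt_id (0 : ℝ)).mul_const ((Pi.single i 1 : Fin n → ℝ) j)).const_add
      (z.2 j)).const_mul η).neg.exp).const_mul (d.eval (z.1 j))).mul_const
      (lagr n α z j x)).div_const (Ader n α z j)
    refine h.congr_deriv ?_
    simp
    ring
  have h : (fun t : ℝ => Cfun n α γ η d x (z + t • (0, Pi.single i 1))) =
      fun t => (γ / α) * Afun n α x z - ∑ j, d.eval (z.1 j) *
        Real.exp (-(η * (z.2 j + t * (Pi.single i 1 : Fin n → ℝ) j))) *
          lagr n α z j x / Ader n α z j := by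
    funext t
    simp [Cfun, Ader_eq_lagr, lagr, Afun]
  rw [h, ((HasDerivAt.fun_sum fun j _ => hterm j).const_sub _).deriv,
    Finset.sum_eq_single i (fun j _ hj => by simp [hj]) (by simp)]
  simp

/-!
STATEMENT 6: {C(x), A(y)}_0 = −(η/(x−y))·(C(x)A(y) − C(y)A(x)) on U.
-/
theorem sklyanin_CA (n : ℕ) (hn : 1 ≤ n) (α γ η : ℝ) (hα : α ≠ 0) (d : Polynomial ℝ)
    (x y : ℝ) (hxy : x ≠ y) (z : (Fin n → ℝ) × (Fin n → ℝ)) (hz : z ∈ U n) :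
    bracket0 (fun w => Cfun n α γ η d x w) (fun w => Afun n α y w) z =
      -(η / (x - y)) *
        (Cfun n α γ η d x z * Afun n α y z - Cfun n α γ η d y z * Afun n α x z) := by
  have hxy' : x - y ≠ 0 := sub_ne_zero.2 hxy
  have hR : Cfun n α γ η d x z * Afun n α y z - Cfun n α γ η d y z * Afun n α x z =
      (x - y) * ∑ i, d.eval (z.1 i) * Real.exp (-(η * z.2 i)) * lagr n α z i x / Ader n α z i *
        lagr n α z i y := by
    have hsum : (∑ i, d.eval (z.1 i) * Real.exp (-(η * z.2 i)) * lagr n α z i y / Ader n α z i) *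
          Afun n α x z -
        (∑ i, d.eval (z.1 i) * Real.exp (-(η * z.2 i)) * lagr n α z i x / Ader n α z i) *
          Afun n α y z =
        (x - y) * ∑ i, d.eval (z.1 i) * Real.exp (-(η * z.2 i)) * lagr n α z i x / Ader n α z i *
          lagr n α z i y := by
      rw [Finset.sum_mul, Finset.sum_mul, Finset.mul_sum, ← Finset.sum_sub_distrib]
      refine Finset.sum_congr rfl fun i _ => ?_
      rw [Afun_eq_mul_lagr n α z i x, Afun_eq_mul_lagr n α z i y]
      ring
    rw [← hsum, Cfun, Cfun]
    ring
  have hL : bracket0 (Cfun n α γ η d x) (Afun n α y) z =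
      -η * ∑ i, d.eval (z.1 i) * Real.exp (-(η * z.2 i)) * lagr n α z i x / Ader n α z i *
        lagr n α z i y := by
    rw [bracket0, Finset.mul_sum]
    refine Finset.sum_congr rfl fun i _ => ?_
    rw [pdMu_Cfun hα γ η d x i hz, pdLam_Afun, pdMu_Afun]
    ring
  rw [hR]
  refine hL.trans ?_
  field_simp

end
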